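/- arXiv:1312.4381 — 6 statements merged into one kernel-verified Lean document; each statement's English description precedes it below -/
import Mathlib

section
/- There exists a da Costa C1 structure (X, P, i, a, o, n) together with elements φ, ψ : X such that P φ and P (n φ) hold but P ψ fails. That is, the axioms of da Costa's logic C1 are consistent with the existence of a provable contradictory pair that does not trivialize the logic; hence C1 admits paraconsistent models. -/
/-- A da Costa C1 structure: a type of propositions with implication `i`,
conjunction `a`, disjunction `o`, negation `n`, and a theoremhood predicate `P`
satisfying the axioms of da Costa's logic C1.  Here `φ∘` abbreviates
`n (a φ (n φ))`. -/
structure DaCostaC1 where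
  X : Type
  P : X → Prop
  i : X → X → X
  a : X → X → X
  o : X → X → X
  n : X → X
  mp : ∀ φ ψ : X, P (i φ ψ) → P φ → P ψ
  A1 : ∀ φ ψ : X, P (i φ (i ψ φ))
  A2 : ∀ φ ψ χ : X, P (i (i φ ψ) (i (i φ (i ψ χ)) (i φ χ)))
  A3 : ∀ φ ψ : X, P (i (a φ ψ) φ)
  A4 : ∀ φ ψ : X, P (i (a φ ψ) ψ)
  A5 : ∀ φ ψ : X, P (i φ (i ψ (a φ ψ)))
  A6 : ∀ φ ψ : X, P (i φ (o φ ψ))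
  A7 : ∀ φ ψ : X, P (i ψ (o φ ψ))
  A8 : ∀ φ ψ χ : X, P (i (i φ χ) (i (i ψ χ) (i (o φ ψ) χ)))
  A9 : ∀ φ : X, P (o φ (n φ))
  A10 : ∀ φ : X, P (i (n (n φ)) φ)
  A11 : ∀ φ ψ : X,
    P (i (n (a ψ (n ψ))) (i (i φ ψ) (i (i φ (n ψ)) (n φ))))
  A12 : ∀ φ ψ : X,
    P (i (a (n (a φ (n φ))) (n (a ψ (n ψ))))
        (a (n (a (i φ ψ) (n (i φ ψ))))
          (a (n (a (a φ ψ) (n (a φ ψ))))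
            (n (a (o φ ψ) (n (o φ ψ)))))))

/-- Sette's three-valued matrix for the logic P1: `0` is true, `1` is true together with its
negation, and `2` is false; `0` and `1` are designated. Every compound formula takes
value `0` or `2`. -/
def setteMatrix : DaCostaC1 where
  X := Fin 3
  P x := x ≠ 2
  i x y := if x ≠ 2 ∧ y = 2 then 2 else 0
  a x y := if x ≠ 2 ∧ y ≠ 2 then 0 else 2
  o x y := if x ≠ 2 ∨ y ≠ 2 then 0 else 2
  n x := if x = 0 then 2 else 0
  mp := by decide
  A1 := by decide
  A2 := by decide
  A3 := by decide
  A4 := by decide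
  A5 := by decide
  A6 := by decide
  A7 := by decide
  A8 := by decide
  A9 := by decide
  A10 := by decide
  A11 := by decide
  A12 := by decide

/-- C1 admits paraconsistent models: there is a C1 structure with a provable
contradictory pair that does not trivialize the logic. -/
theorem c1_paraconsistent_model :
    ∃ (S : DaCostaC1) (φ ψ : S.X), S.P φ ∧ S.P (S.n φ) ∧ ¬ S.P ψ := by
  refine ⟨setteMatrix, (1 : Fin 3), (2 : Fin 3), ?_, ?_, ?_⟩ <;> simp [setteMatrix]
end

section
/- There exists a da Costa C1 structure (X, P, i, a, o, n) together with elements φ, ψ : X such that P (i (a φ (n φ)) ψ) fails. That is, one cannot prove from the axioms of C1 that, for every φ, the formula φ ∧ ¬φ is explosive: there is a model of C1 in which some conjunction of a proposition with its negation does not entail every proposition. -/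
/-- The truth values of Sette's three-valued logic: `some true` and `some false` are the classical
ones, and `none` is the additional designated value. This is the designation map. -/
abbrev setteDesignated (x : Option Bool) : Bool := x.getD true

/-- Negation in Sette's logic: the extra value is designated together with its negation. -/
abbrev setteNeg (x : Option Bool) : Option Bool := some (!x.getD false)

/-- Sette's three-valued matrix, as a model of C1. The binary connectives take only classical
values and act classically on designation. -/
abbrev setteModel : DaCostaC1 where
  X := Option Bool
  P x := setteDesignated x = true
  i x y := some (!setteDesignated x || setteDesignated y)
  a x y := some (setteDesignated x && setteDesignated y)
  o x y := some (setteDesignated x || setteDesignated y)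
  n := setteNeg
  mp := by decide
  A1 := by decide
  A2 := by decide
  A3 := by decide
  A4 := by decide
  A5 := by decide
  A6 := by decide
  A7 := by decide
  A8 := by decide
  A9 := by decide
  A10 := by decide
  A11 := by decide
  A12 := by decide

/-- One cannot prove in C1 that every formula `φ ∧ ¬φ` is explosive: there is a
model of C1 in which some conjunction of a proposition with its negation does
not entail every proposition. -/
theorem c1_contradiction_not_explosive :
    ∃ (S : DaCostaC1) (φ ψ : S.X), ¬ S.P (S.i (S.a φ (S.n φ)) ψ) := by
  exact ⟨setteModel, none, some false, by decide⟩
end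

section
/- There exists a type X with operations i, a, o : X → X → X, n : X → X and a predicate P : X → Prop satisfying modus ponens, the positive axioms A1–A8, double negation elimination A10, the consistency axioms A11 and A12, and the explosion principle P (i φ (i (n φ) ψ)) for all φ, ψ, but in which the principle of excluded middle fails for some element: there is a φ with ¬ P (o φ (n φ)). That is, even if the explosion principle is postulated, the principle of excluded middle cannot be deleted (it is not derivable from the remaining axioms together with explosion). -/
/-- Even if the explosion principle is postulated, excluded middle cannot be
deleted: there is a structure satisfying modus ponens, A1–A8, A10, A11, A12
and explosion, in which excluded middle fails for some element. -/
theorem excluded_middle_independent_of_explosion :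
    ∃ (X : Type) (P : X → Prop) (i a o : X → X → X) (n : X → X),
      (∀ φ ψ : X, P (i φ ψ) → P φ → P ψ) ∧
      (∀ φ ψ : X, P (i φ (i ψ φ))) ∧
      (∀ φ ψ χ : X, P (i (i φ ψ) (i (i φ (i ψ χ)) (i φ χ)))) ∧
      (∀ φ ψ : X, P (i (a φ ψ) φ)) ∧
      (∀ φ ψ : X, P (i (a φ ψ) ψ)) ∧
      (∀ φ ψ : X, P (i φ (i ψ (a φ ψ)))) ∧
      (∀ φ ψ : X, P (i φ (o φ ψ))) ∧
      (∀ φ ψ : X, P (i ψ (o φ ψ))) ∧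
      (∀ φ ψ χ : X, P (i (i φ χ) (i (i ψ χ) (i (o φ ψ) χ)))) ∧
      (∀ φ : X, P (i (n (n φ)) φ)) ∧
      (∀ φ ψ : X,
        P (i (n (a ψ (n ψ))) (i (i φ ψ) (i (i φ (n ψ)) (n φ))))) ∧
      (∀ φ ψ : X,
        P (i (a (n (a φ (n φ))) (n (a ψ (n ψ))))
            (a (n (a (i φ ψ) (n (i φ ψ))))
              (a (n (a (a φ ψ) (n (a φ ψ))))
                (n (a (o φ ψ) (n (o φ ψ)))))))) ∧
      (∀ φ ψ : X, P (i φ (i (n φ) ψ))) ∧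
      (∃ φ : X, ¬ P (o φ (n φ))) := by
  -- Classical two-valued semantics, except that every negation is false.
  refine ⟨Bool, (· = true), fun x y => !x || y, and, or, fun _ => false, ?_⟩
  decide
end

section
/- Let X be a type with operations i, a, o : X → X → X, n : X → X and a predicate P : X → Prop satisfying modus ponens, the positive axioms A1–A8, excluded middle A9, double negation elimination A10, and the explosion principle P (i φ (i (n φ) ψ)) for all φ, ψ. Then da Costa's consistency axiom schema A11 is derivable: for all φ, ψ : X, P (i (n (a ψ (n ψ))) (i (i φ ψ) (i (i φ (n ψ)) (n φ)))). Hence, if the explosion principle is postulated, the axioms of C1 governing the consistency operator become dependent and can be deleted. -/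
/-- In any structure satisfying modus ponens, A1–A8, excluded middle A9, double
negation elimination A10, and the explosion principle, da Costa's consistency
axiom schema A11 is derivable. -/
theorem a11_derivable_from_explosion
    (X : Type) (P : X → Prop) (i a o : X → X → X) (n : X → X)
    (mp : ∀ φ ψ : X, P (i φ ψ) → P φ → P ψ)
    (A1 : ∀ φ ψ : X, P (i φ (i ψ φ)))
    (A2 : ∀ φ ψ χ : X, P (i (i φ ψ) (i (i φ (i ψ χ)) (i φ χ))))
    (A3 : ∀ φ ψ : X, P (i (a φ ψ) φ))
    (A4 : ∀ φ ψ : X, P (i (a φ ψ) ψ))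
    (A5 : ∀ φ ψ : X, P (i φ (i ψ (a φ ψ))))
    (A6 : ∀ φ ψ : X, P (i φ (o φ ψ)))
    (A7 : ∀ φ ψ : X, P (i ψ (o φ ψ)))
    (A8 : ∀ φ ψ χ : X, P (i (i φ χ) (i (i ψ χ) (i (o φ ψ) χ))))
    (A9 : ∀ φ : X, P (o φ (n φ)))
    (A10 : ∀ φ : X, P (i (n (n φ)) φ))
    (expl : ∀ φ ψ : X, P (i φ (i (n φ) ψ))) :
    ∀ φ ψ : X,
      P (i (n (a ψ (n ψ))) (i (i φ ψ) (i (i φ (n ψ)) (n φ)))) := by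
  have s : ∀ {c x y : X}, P (i c (i x y)) → P (i c x) → P (i c y) := fun h k =>
    mp _ _ (mp _ _ (A2 _ _ _) k) h
  have k : ∀ {c x : X}, P x → P (i c x) := fun h => mp _ _ (A1 _ _) h
  have identity : ∀ x : X, P (i x x) := fun x => s (A1 x (i x x)) (A1 x x)
  have syll : ∀ {x y z : X}, P (i x y) → P (i y z) → P (i x z) := fun h g => s (k g) h
  have lift : ∀ {x y z : X}, P (i x (i y z)) → P (i (i x y) (i x z)) := fun h =>
    s (A2 _ _ _) (k h)
  have swap : ∀ {x y z : X}, P (i x (i y z)) → P (i y (i x z)) := fun h =>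
    syll (A1 _ _) (lift h)
  have post : ∀ {x y z : X}, P (i y z) → P (i (i x y) (i x z)) := fun h => lift (k h)
  intro φ ψ
  have clavius : P (i (i φ (n φ)) (n φ)) :=
    s (s (A8 φ (n φ) (n φ)) (k (identity _))) (k (A9 φ))
  have contra : P (i (i φ (i (n ψ) (n φ))) (i (i φ (n ψ)) (n φ))) :=
    syll (swap (A2 φ (n ψ) (n φ))) (post clavius)
  exact k (syll (post (expl ψ (n φ))) contra)
end

section
/- There exists a da Costa C1 structure (X, P, i, a, o, n) together with an element b : X that is ⊥-like, i.e., P (i b ψ) holds for all ψ : X, while the structure remains paraconsistent: there exist φ, ψ : X with ¬ P (i φ (i (n φ) ψ)). That is, the existence of a ⊥-like formula is consistent with the axioms of C1 and with paraconsistency. -/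
/-- The truth values of Sette's three-valued logic P1; `glut` is the value of a formula
that holds together with its negation. -/
inductive SetteValue where
  | false
  | glut
  | true
  deriving DecidableEq

namespace SetteValue

instance : Fintype SetteValue where
  elems := {false, glut, true}
  complete x := by cases x <;> decide

/-- A truth value is designated if it is not `false`. -/
def Designated (x : SetteValue) : Prop := x ≠ false

instance : DecidablePred Designated := fun x => inferInstanceAs (Decidable (x ≠ false))

/-- The classical truth value of a decidable proposition. -/
def ofProp (p : Prop) [Decidable p] : SetteValue := if p then true else false

/-- Implication in Sette's logic, which never takes the value `glut`. -/
def imp (x y : SetteValue) : SetteValue := ofProp (x.Designated → y.Designated)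

/-- Conjunction in Sette's logic, which never takes the value `glut`. -/
def conj (x y : SetteValue) : SetteValue := ofProp (x.Designated ∧ y.Designated)

/-- Disjunction in Sette's logic, which never takes the value `glut`. -/
def disj (x y : SetteValue) : SetteValue := ofProp (x.Designated ∨ y.Designated)

/-- Negation in Sette's logic: the negation of `glut` is designated. -/
def neg (x : SetteValue) : SetteValue := ofProp (x ≠ true)

end SetteValue

open SetteValue in
/-- Sette's three-valued matrix is a model of da Costa's C1. -/
def setteC1 : DaCostaC1 where
  X := SetteValue
  P := Designated
  i := imp
  a := conj
  o := disj
  n := neg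
  mp := by decide
  A1 := by decide
  A2 := by decide
  A3 := by decide
  A4 := by decide
  A5 := by decide
  A6 := by decide
  A7 := by decide
  A8 := by decide
  A9 := by decide
  A10 := by decide
  A11 := by decide
  A12 := by decide

/-- A ⊥-like formula is consistent with the axioms of C1 and with
paraconsistency. -/
theorem c1_bottom_like_consistent_with_paraconsistency :
    ∃ (S : DaCostaC1) (b : S.X),
      (∀ ψ : S.X, S.P (S.i b ψ)) ∧
      ∃ φ ψ : S.X, ¬ S.P (S.i φ (S.i (S.n φ) ψ)) := by
  have bottom_like : ∀ ψ, (SetteValue.false.imp ψ).Designated := by decide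
  have not_explosive :
      ¬ (SetteValue.glut.imp (SetteValue.glut.neg.imp .false)).Designated := by decide
  exact ⟨setteC1, SetteValue.false, bottom_like, SetteValue.glut, SetteValue.false, not_explosive⟩
end

section
/- Let (X, P, i, a, o, n) be any da Costa C1 structure. Then for all φ, χ : X, the finite gentle explosion theorem holds: P (i (n (a φ (n φ))) (i φ (i (n φ) χ))). That is, C1 proves φ∘ → (φ → (¬φ → χ)) for all φ and χ: a contradictory pair together with the consistency formula of its member is explosive. -/
namespace DaCostaC1

variable (S : DaCostaC1)

/-- Modus ponens under a common antecedent. -/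
theorem mp_under {γ φ ψ : S.X} (h : S.P (S.i γ (S.i φ ψ))) (hφ : S.P (S.i γ φ)) :
    S.P (S.i γ ψ) :=
  S.mp _ _ (S.mp _ _ (S.A2 γ φ ψ) hφ) h

theorem weaken (γ : S.X) {φ : S.X} (h : S.P φ) : S.P (S.i γ φ) :=
  S.mp _ _ (S.A1 φ γ) h

theorem imp_trans {φ ψ χ : S.X} (h : S.P (S.i φ ψ)) (h' : S.P (S.i ψ χ)) :
    S.P (S.i φ χ) :=
  S.mp_under (S.weaken φ h') h

/-- Implication is monotone in its consequent. -/
theorem imp_mono_right (φ : S.X) {ψ χ : S.X} (h : S.P (S.i ψ χ)) :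
    S.P (S.i (S.i φ ψ) (S.i φ χ)) :=
  S.mp_under (S.A2 φ ψ χ) (S.weaken _ (S.weaken φ h))

/-- Implication is antitone in its antecedent. -/
theorem imp_anti_left {φ ψ : S.X} (χ : S.X) (h : S.P (S.i φ ψ)) :
    S.P (S.i (S.i ψ χ) (S.i φ χ)) :=
  S.imp_trans (S.A1 _ φ) (S.mp _ _ (S.A2 φ ψ χ) h)

end DaCostaC1

/-- Finite gentle explosion in C1: `φ∘ → (φ → (¬φ → χ))` is a theorem. -/
theorem c1_finite_gentle_explosion (S : DaCostaC1) :
    ∀ φ χ : S.X,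
      S.P (S.i (S.n (S.a φ (S.n φ))) (S.i φ (S.i (S.n φ) χ))) := by
  intro φ χ
  have step : S.P (S.i (S.i (S.i (S.n χ) (S.n φ)) (S.n (S.n χ))) (S.i (S.n φ) χ)) :=
    S.imp_trans (S.imp_anti_left _ (S.A1 (S.n φ) (S.n χ))) (S.imp_mono_right _ (S.A10 χ))
  exact S.imp_trans (S.A11 (S.n χ) φ)
    (S.imp_trans (S.imp_mono_right _ step) (S.imp_anti_left _ (S.A1 φ (S.n χ))))
end
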